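/- arXiv:2408.10224 — 2 statements merged into one kernel-verified Lean document; each statement's English description precedes it below -/
import Mathlib

section
/- For all natural numbers m, n, the two forms of the Born–Jordan quantization of the monomial x^m p^n agree as operators on 𝒮(ℝ, ℂ): (1/(m+1)) Σ_{k=0}^{m} x̂^{m−k} p̂^n x̂^{k} = (1/(n+1)) Σ_{k=0}^{n} p̂^{n−k} x̂^m p̂^{k}. -/
open SchwartzMap Finset

theorem sum_pow_mul_commutator_mul_pow {A : Type*} [Ring A] (a b : A) (n : ℕ) :
    ∑ k ∈ range (n + 1), a ^ (n - k) * (a * b - b * a) * a ^ k =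
      a ^ (n + 1) * b - b * a ^ (n + 1) := by
  have h := Finset.sum_range_sub' (fun k => a ^ (n + 1 - k) * b * a ^ k) (n + 1)
  simp only [Nat.sub_zero, pow_zero, mul_one, Nat.sub_self, one_mul] at h
  rw [← h]
  refine Finset.sum_congr rfl fun k hk => ?_
  have hk' : n + 1 - k = (n - k) + 1 := by
    have := Finset.mem_range.mp hk
    omega
  rw [hk', Nat.add_sub_add_right, pow_succ, pow_succ']
  noncomm_ring

theorem pow_succ_commutator_of_commutator_eq_smul_one {K A : Type*} [Field K] [Ring A]
    [Algebra K A] {a b : A} {c : K} (h : a * b - b * a = c • 1) (n : ℕ) :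
    a ^ (n + 1) * b - b * a ^ (n + 1) = (c * ((n : K) + 1)) • a ^ n := by
  rw [← sum_pow_mul_commutator_mul_pow, h]
  have hterm : ∀ k ∈ range (n + 1), a ^ (n - k) * (c • (1 : A)) * a ^ k = c • a ^ n := by
    intro k hk
    rw [mul_smul_comm, mul_one, smul_mul_assoc, ← pow_add,
      Nat.sub_add_cancel (Nat.lt_succ_iff.mp (Finset.mem_range.mp hk))]
  rw [Finset.sum_congr rfl hterm, Finset.sum_const, Finset.card_range,
    ← Nat.cast_smul_eq_nsmul K, smul_smul, mul_comm, Nat.cast_add_one]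

/-- If `[a, b] = c`, then `c (m + 1) (n + 1)` times the Born–Jordan average of `a ^ m b ^ n`
is the commutator `[a ^ (m + 1), b ^ (n + 1)]`. -/
theorem smul_bornJordan_eq_commutator {K A : Type*} [Field K] [CharZero K] [Ring A]
    [Algebra K A] {a b : A} {c : K} (h : a * b - b * a = c • 1) (m n : ℕ) :
    (c * ((m : K) + 1) * ((n : K) + 1)) •
        (((m : K) + 1)⁻¹ • ∑ k ∈ range (m + 1), a ^ (m - k) * b ^ n * a ^ k) =
      a ^ (m + 1) * b ^ (n + 1) - b ^ (n + 1) * a ^ (m + 1) := by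
  have hm : (m : K) + 1 ≠ 0 := Nat.cast_add_one_ne_zero m
  have h' : b * a - a * b = (-c) • (1 : A) := by rw [neg_smul, ← h, neg_sub]
  have hb : a * b ^ (n + 1) - b ^ (n + 1) * a = (c * ((n : K) + 1)) • b ^ n := by
    rw [← neg_sub, pow_succ_commutator_of_commutator_eq_smul_one h', neg_mul, neg_smul, neg_neg]
  rw [← sum_pow_mul_commutator_mul_pow, hb, smul_smul, mul_right_comm c,
    mul_inv_cancel_right₀ hm, Finset.smul_sum]
  simp only [mul_smul_comm, smul_mul_assoc]

theorem bornJordan_eq_of_commutator_eq_smul_one {K A : Type*} [Field K] [CharZero K] [Ring A]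
    [Algebra K A] {a b : A} {c : K} (hc : c ≠ 0) (h : a * b - b * a = c • 1) (m n : ℕ) :
    ((m : K) + 1)⁻¹ • ∑ k ∈ range (m + 1), a ^ (m - k) * b ^ n * a ^ k =
      ((n : K) + 1)⁻¹ • ∑ k ∈ range (n + 1), b ^ (n - k) * a ^ m * b ^ k := by
  have h' : b * a - a * b = (-c) • (1 : A) := by rw [neg_smul, ← h, neg_sub]
  have hne : c * ((m : K) + 1) * ((n : K) + 1) ≠ 0 :=
    mul_ne_zero (mul_ne_zero hc (Nat.cast_add_one_ne_zero m)) (Nat.cast_add_one_ne_zero n)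
  refine (smul_right_injective A hne) ?_
  have hba := smul_bornJordan_eq_commutator h' n m
  rw [neg_mul, neg_mul, neg_smul, neg_eq_iff_eq_neg, neg_sub, mul_right_comm] at hba
  exact (smul_bornJordan_eq_commutator h m n).trans hba.symm

/-- The canonical commutation relation on Schwartz space. -/
theorem position_momentum_commutator (ℏ : ℝ) (X P : 𝓢(ℝ, ℂ) →L[ℂ] 𝓢(ℝ, ℂ))
    (hX : ∀ (f : 𝓢(ℝ, ℂ)) (x : ℝ), X f x = x * f x)
    (hP : ∀ (f : 𝓢(ℝ, ℂ)) (x : ℝ), P f x = -(Complex.I * ℏ) * deriv (⇑f) x) :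
    X * P - P * X = (Complex.I * ℏ) • (1 : 𝓢(ℝ, ℂ) →L[ℂ] 𝓢(ℝ, ℂ)) := by
  ext f x
  have hXf : ⇑(X f) = fun y : ℝ => (y : ℂ) * f y := funext (hX f)
  have hd : deriv (⇑(X f)) x = f x + x * deriv (⇑f) x := by
    rw [hXf]
    have h := (hasDerivAt_id x).ofReal_comp.mul (f.differentiableAt (x := x)).hasDerivAt
    exact h.deriv.trans (by simp)
  change X (P f) x - P (X f) x = (Complex.I * ℏ) * f x
  rw [hX, hP, hP, hd]
  ring

set_option synthInstance.maxHeartbeats 1000000 in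
/-- The two forms of the Born–Jordan quantization of the monomial `x^m p^n`
agree as operators on Schwartz space. -/
theorem born_jordan_quantization_two_forms (ℏ : ℝ) (hℏ : 0 < ℏ)
    (X P : 𝓢(ℝ, ℂ) →L[ℂ] 𝓢(ℝ, ℂ))
    (hX : ∀ (f : 𝓢(ℝ, ℂ)) (x : ℝ), X f x = x * f x)
    (hP : ∀ (f : 𝓢(ℝ, ℂ)) (x : ℝ), P f x = -(Complex.I * ℏ) * deriv (⇑f) x)
    (m n : ℕ) :
    ((m : ℂ) + 1)⁻¹ • ∑ k ∈ range (m + 1), X ^ (m - k) * P ^ n * X ^ k =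
      ((n : ℂ) + 1)⁻¹ • ∑ k ∈ range (n + 1), P ^ (n - k) * X ^ m * P ^ k := by
  exact bornJordan_eq_of_commutator_eq_smul_one
    (mul_ne_zero Complex.I_ne_zero (Complex.ofReal_ne_zero.mpr hℏ.ne'))
    (position_momentum_commutator ℏ X P hX hP) m n
end

section
/- In dimension four, the Weyl quantization of the squared angular momentum l² = (1/2) Σ_{i,j=1}^{4} l_{ij}² = Σ_{1≤i<j≤4} l_{ij}² exceeds l̂² by 3ℏ²: as operators on 𝒮(ℝ⁴, ℂ), Σ_{1≤i<j≤4} [ x̂_i² p̂_j² + x̂_j² p̂_i² − 2 · ((x̂_ip̂_i + p̂_ix̂_i)/2) · ((x̂_jp̂_j + p̂_jx̂_j)/2) ] = l̂² + 3ℏ²·id, where l̂² = Σ_{1≤i<j≤4} l̂_{ij}² and l̂_{ij} = x̂_ip̂_j − x̂_jp̂_i. -/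
open SchwartzMap Finset

set_option synthInstance.maxHeartbeats 1000000

/-- The Weyl quantization of `l_{ij}² = (x_i p_j − x_j p_i)²` in one conjugate
pair of indices in dimension four. -/
noncomputable def weylTermL2Four
    (X P : Fin 4 → (𝓢(EuclideanSpace ℝ (Fin 4), ℂ) →L[ℂ] 𝓢(EuclideanSpace ℝ (Fin 4), ℂ)))
    (i j : Fin 4) : 𝓢(EuclideanSpace ℝ (Fin 4), ℂ) →L[ℂ] 𝓢(EuclideanSpace ℝ (Fin 4), ℂ) :=
  (X i) ^ 2 * (P j) ^ 2 + (X j) ^ 2 * (P i) ^ 2 -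
    (2 : ℂ) • (((1 / 2 : ℂ) • (X i * P i + P i * X i)) *
      ((1 / 2 : ℂ) • (X j * P j + P j * X j)))

/-- For two commuting conjugate pairs `(x, p)`, `(y, q)` with `[x, p] = [y, q] = c`, the Weyl
ordering of `(x q - y p)²` differs from the operator square by the scalar `-c² / 2`. -/
theorem weyl_sq_eq_sq_sub_of_canonical_commutation {R : Type*} [Ring R] [Algebra ℂ R]
    {x y p q : R} {c : ℂ} (hxy : x * y = y * x) (hpq : p * q = q * p) (hxq : q * x = x * q)
    (hyp : p * y = y * p) (hxp : p * x = x * p - c • 1) (hyq : q * y = y * q - c • 1) :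
    x ^ 2 * q ^ 2 + y ^ 2 * p ^ 2 -
      (2 : ℂ) • (((1 / 2 : ℂ) • (x * p + p * x)) * ((1 / 2 : ℂ) • (y * q + q * y))) =
    (x * q - y * p) ^ 2 - (c ^ 2 / 2) • (1 : R) := by
  have hyx_mul (z : R) : y * (x * z) = x * (y * z) := by rw [← mul_assoc, ← hxy, mul_assoc]
  have hqx_mul (z : R) : q * (x * z) = x * (q * z) := by rw [← mul_assoc, hxq, mul_assoc]
  have hpy_mul (z : R) : p * (y * z) = y * (p * z) := by rw [← mul_assoc, hyp, mul_assoc]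
  have hpx_mul (z : R) : p * (x * z) = x * (p * z) - c • z := by
    rw [← mul_assoc, hxp, sub_mul, mul_assoc, smul_one_mul]
  have hqy_mul (z : R) : q * (y * z) = y * (q * z) - c • z := by
    rw [← mul_assoc, hyq, sub_mul, mul_assoc, smul_one_mul]
  simp only [pow_two, mul_add, add_mul, mul_sub, sub_mul, mul_assoc, smul_mul_assoc, mul_smul_comm,
    hyx_mul, hqx_mul, hpy_mul, hpx_mul, hqy_mul, hpq.symm, hxp, hyq, mul_one,
    one_mul]
  module

section Schwartz

variable {E : Type*} [NormedAddCommGroup E] [NormedSpace ℝ E]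

theorem SchwartzMap.fderiv_const_mul_fderiv_apply (f : 𝓢(E, ℂ)) (a : ℂ) (x v w : E) :
    fderiv ℝ (fun y => a * fderiv ℝ f y v) x w = a * fderiv ℝ (fderiv ℝ f) x w v := by
  have hd : DifferentiableAt ℝ (fderiv ℝ f) x :=
    (((f.smooth 2).fderiv_right (m := 1) (by norm_num)).differentiable (by norm_num)) x
  have h := ((hd.hasFDerivAt.clm_apply (hasFDerivAt_const v x)).const_mul a).fderiv
  rw [h]
  simp

theorem SchwartzMap.fderiv_fderiv_comm (f : 𝓢(E, ℂ)) (x v w : E) :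
    fderiv ℝ (fderiv ℝ f) x v w = fderiv ℝ (fderiv ℝ f) x w v :=
  ((f.smooth 2).contDiffAt.isSymmSndFDerivAt (by simp)).eq v w

end Schwartz

section Operators

variable {ι : Type*} [Fintype ι]
  {X P : ι → 𝓢(EuclideanSpace ℝ ι, ℂ) →L[ℂ] 𝓢(EuclideanSpace ℝ ι, ℂ)}

theorem position_mul_comm (hX : ∀ j f x, X j f x = x j * f x) (i j : ι) :
    X i * X j = X j * X i := by
  ext f x
  simp only [mul_apply_eq_comp, hX]
  ring

theorem momentum_mul_comm [DecidableEq ι] {a : ℂ}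
    (hP : ∀ j f x, P j f x = a * fderiv ℝ f x (EuclideanSpace.single j 1)) (i j : ι) :
    P i * P j = P j * P i := by
  ext f x
  have hfun (k : ι) : ⇑(P k f) = fun y => a * fderiv ℝ f y (EuclideanSpace.single k 1) :=
    funext (hP k f)
  simp only [mul_apply_eq_comp, hP _ (P _ f), hfun]
  rw [f.fderiv_const_mul_fderiv_apply, f.fderiv_const_mul_fderiv_apply, f.fderiv_fderiv_comm]

theorem momentum_mul_position [DecidableEq ι] {a : ℂ}
    (hX : ∀ j f x, X j f x = x j * f x)
    (hP : ∀ j f x, P j f x = a * fderiv ℝ f x (EuclideanSpace.single j 1)) (i j : ι) :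
    P i * X j = X j * P i + (if i = j then a else 0) • 1 := by
  ext f x
  have hfun : ⇑(X j f) = (fun y => ((y j : ℝ) : ℂ)) * ⇑f := funext (hX j f)
  have hcoord : HasFDerivAt (fun y : EuclideanSpace ℝ ι => ((y j : ℝ) : ℂ))
      (Complex.ofRealCLM.comp (EuclideanSpace.proj j)) x :=
    (Complex.ofRealCLM.comp (EuclideanSpace.proj j : EuclideanSpace ℝ ι →L[ℝ] ℝ)).hasFDerivAt
  have hd := (hcoord.mul (f.hasFDerivAt x)).fderiv
  simp only [mul_apply_eq_comp, add_apply, hP, hX, hfun]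
  rw [hd]
  by_cases h : i = j
  · subst h
    simp
    ring
  · simp [h, Ne.symm h]
    ring

end Operators

/-- In dimension four the Weyl quantization of the squared angular momentum
`l² = Σ_{i<j} l_{ij}²` exceeds `l̂² = Σ_{i<j} (x̂_ip̂_j − x̂_jp̂_i)²` by `3ℏ²`. -/
theorem weyl_quantization_angular_momentum_squared_dim4 (ℏ : ℝ) (hℏ : 0 < ℏ)
    (X P : Fin 4 → (𝓢(EuclideanSpace ℝ (Fin 4), ℂ) →L[ℂ] 𝓢(EuclideanSpace ℝ (Fin 4), ℂ)))
    (hX : ∀ (j : Fin 4) (f : 𝓢(EuclideanSpace ℝ (Fin 4), ℂ)) (x : EuclideanSpace ℝ (Fin 4)),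
      X j f x = x j * f x)
    (hP : ∀ (j : Fin 4) (f : 𝓢(EuclideanSpace ℝ (Fin 4), ℂ)) (x : EuclideanSpace ℝ (Fin 4)),
      P j f x = -(Complex.I * ℏ) * fderiv ℝ (⇑f) x (EuclideanSpace.single j 1)) :
    (∑ q ∈ univ.filter (fun q : Fin 4 × Fin 4 => q.1 < q.2), weylTermL2Four X P q.1 q.2) =
      (∑ q ∈ univ.filter (fun q : Fin 4 × Fin 4 => q.1 < q.2),
          (X q.1 * P q.2 - X q.2 * P q.1) ^ 2) +
        ((3 : ℂ) * (ℏ : ℂ) ^ 2) •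
          (1 : 𝓢(EuclideanSpace ℝ (Fin 4), ℂ) →L[ℂ] 𝓢(EuclideanSpace ℝ (Fin 4), ℂ)) := by
  have hpx (i : Fin 4) : P i * X i = X i * P i - (Complex.I * ℏ) • 1 := by
    rw [momentum_mul_position hX hP, if_pos rfl, neg_smul, sub_eq_add_neg]
  have hpx_ne {i j : Fin 4} (h : i ≠ j) : P i * X j = X j * P i := by
    rw [momentum_mul_position hX hP, if_neg h, zero_smul, add_zero]
  have hterm : ∀ q ∈ univ.filter (fun q : Fin 4 × Fin 4 => q.1 < q.2),
      weylTermL2Four X P q.1 q.2 =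
        (X q.1 * P q.2 - X q.2 * P q.1) ^ 2 + ((ℏ : ℂ) ^ 2 / 2) • 1 := by
    intro q hq
    have hne : q.1 ≠ q.2 := (mem_filter.mp hq).2.ne
    rw [weylTermL2Four, weyl_sq_eq_sq_sub_of_canonical_commutation
      (position_mul_comm hX _ _) (momentum_mul_comm hP _ _) (hpx_ne hne.symm) (hpx_ne hne)
      (hpx _) (hpx _), mul_pow, Complex.I_sq]
    module
  have hcard : (univ.filter (fun q : Fin 4 × Fin 4 => q.1 < q.2)).card = 6 := by decide
  rw [sum_congr rfl hterm, sum_add_distrib, sum_const, hcard]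
  module
end
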